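/- Let (W,S) be a Coxeter system and I, J ⊆ S connected subsets (the induced Coxeter graphs on I and J are connected). If the projections P^I and P^J commute as functions W → W, then either every generator in I commutes with every generator in J (m(s,t) ≤ 2 for all s ∈ I, t ∈ J), or I ⊆ J, or J ⊆ I. -/

import Mathlib

open CoxeterSystem

variable {B W : Type*} [Group W] {M : CoxeterMatrix B}

/-- The standard parabolic subgroup `W_J`. -/
def CoxeterSystem.parabolic (cs : CoxeterSystem M W) (J : Set B) : Subgroup W :=
  Subgroup.closure (cs.simple '' J)

/-- The set of minimal-length left coset representatives `W^J`. -/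
def CoxeterSystem.minReps (cs : CoxeterSystem M W) (J : Set B) : Set W :=
  {w : W | ∀ s ∈ J, cs.length w < cs.length (w * cs.simple s)}

/-- `P` is the family of parabolic projections `P^J : W → W`, `w ↦ w^J`. -/
def CoxeterSystem.IsProjFamily (cs : CoxeterSystem M W) (P : Set B → W → W) : Prop :=
  ∀ (J : Set B) (w : W), P J w ∈ cs.minReps J ∧ (P J w)⁻¹ * w ∈ cs.parabolic J


/-- A subset `K ⊆ S` is connected if the Coxeter graph restricted to `K` (edges between
non-commuting pairs of generators, i.e. `m(s,t) ≥ 3`) is connected. -/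
def CoxeterSystem.IsConnected (cs : CoxeterSystem M W) (K : Set B) : Prop :=
  K.Nonempty ∧ ∀ s ∈ K, ∀ t ∈ K,
    Relation.ReflTransGen
      (fun a b => a ∈ K ∧ b ∈ K ∧ ¬ Commute (cs.simple a) (cs.simple b)) s t

open Polynomial.Chebyshev in
/-- The two Chebyshev expressions in `Module.reflection_mul_reflection_pow_apply` vanish at
`2 cos (2π / m)`. -/
lemma chebyshev_S_eval_two_mul_cos_eq_zero {m : ℕ} (hm : 3 ≤ m) (t : ℝ)
    (ht : t = 2 * Real.cos (2 * Real.pi / m)) :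
    (S ℝ (((m : ℤ) - 2) / 2)).eval t *
        ((S ℝ (((m : ℤ) - 1) / 2)).eval t + (S ℝ (((m : ℤ) - 3) / 2)).eval t) = 0 ∧
      (S ℝ (((m : ℤ) - 1) / 2)).eval t *
        ((S ℝ ((m : ℤ) / 2)).eval t + (S ℝ (((m : ℤ) - 2) / 2)).eval t) = 0 := by
  have hm' : (3 : ℝ) ≤ m := by exact_mod_cast hm
  have hθ : m * (2 * Real.pi / m) = 2 * Real.pi := by field_simp
  set θ := 2 * Real.pi / m with hθdef
  have hsin : Real.sin θ ≠ 0 := by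
    refine (Real.sin_pos_of_pos_of_lt_pi (by positivity) ?_).ne'
    rw [hθdef, div_lt_iff₀ (by linarith)]
    nlinarith [Real.pi_pos]
  have hS (n : ℤ) : (S ℝ n).eval t * Real.sin θ = Real.sin ((n + 1) * θ) := by
    rw [ht]; exact S_two_mul_real_cos θ n
  obtain ⟨k, rfl | rfl⟩ := Nat.even_or_odd' m
  · have h : (S ℝ ((k : ℤ) - 1)).eval t = 0 := by
      refine (mul_eq_zero.mp ((hS _).trans ?_)).resolve_right hsin
      have : (((k : ℤ) - 1 : ℤ) + 1 : ℝ) * θ = Real.pi := by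
        push_cast at hθ ⊢; linarith
      rw [this, Real.sin_pi]
    rw [show (((2 * k : ℕ) : ℤ) - 2) / 2 = k - 1 by omega,
      show (((2 * k : ℕ) : ℤ) - 1) / 2 = k - 1 by omega, h]
    simp
  · have h : (S ℝ (k : ℤ)).eval t + (S ℝ ((k : ℤ) - 1)).eval t = 0 := by
      refine (mul_eq_zero.mp (?_ : _ * Real.sin θ = 0)).resolve_right hsin
      rw [add_mul, hS, hS]
      have : ((k : ℤ) + 1 : ℝ) * θ = 2 * Real.pi - (((k : ℤ) - 1 : ℤ) + 1 : ℝ) * θ := by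
        push_cast at hθ ⊢; linarith
      rw [this, Real.sin_two_pi_sub, neg_add_cancel]
    rw [show (((2 * k + 1 : ℕ) : ℤ) - 2) / 2 = k - 1 by omega,
      show (((2 * k + 1 : ℕ) : ℤ) - 1) / 2 = k by omega,
      show (((2 * k + 1 : ℕ) : ℤ) - 3) / 2 = k - 1 by omega,
      show ((2 * k + 1 : ℕ) : ℤ) / 2 = k by omega, h]
    simp

/-- The coroot of `i` in the geometric representation. -/
noncomputable def CoxeterMatrix.coroot (M : CoxeterMatrix B) (i : B) :
    Module.Dual ℝ (B →₀ ℝ) :=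
  Finsupp.linearCombination ℝ fun j => -2 * Real.cos (Real.pi / M i j)

lemma CoxeterMatrix.coroot_single (M : CoxeterMatrix B) (i j : B) :
    M.coroot i (Finsupp.single j 1) = -2 * Real.cos (Real.pi / M i j) := by
  simp [coroot]

lemma CoxeterMatrix.coroot_single_self (M : CoxeterMatrix B) (i : B) :
    M.coroot i (Finsupp.single i 1) = 2 := by
  simp [coroot_single]

/-- The reflection by which `i` acts in the geometric representation. -/
noncomputable def CoxeterMatrix.geomReflection (M : CoxeterMatrix B) (i : B) :
    (B →₀ ℝ) ≃ₗ[ℝ] (B →₀ ℝ) :=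
  Module.reflection (M.coroot_single_self i)

lemma CoxeterMatrix.isLiftable_geomReflection (M : CoxeterMatrix B) :
    M.IsLiftable M.geomReflection := by
  intro i j
  by_cases hij : i = j
  · subst hij
    ext1 z
    simp only [M.diagonal, pow_one, LinearEquiv.mul_apply, geomReflection]
    exact Module.involutive_reflection _ z
  rcases Nat.lt_or_ge (M i j) 3 with h | h
  · have h1 := M.off_diagonal i j hij
    obtain h0 | h2 : M i j = 0 ∨ M i j = 2 := by omega
    · rw [h0, pow_zero]
    · have hi : M.coroot i (Finsupp.single j 1) = 0 := by simp [coroot_single, h2]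
      have hj : M.coroot j (Finsupp.single i 1) = 0 := by simp [coroot_single, M.symmetric j i, h2]
      ext1 z
      simp only [h2, pow_two, LinearEquiv.mul_apply, geomReflection, Module.reflection_apply,
        map_sub, map_smul, hi, hj, coroot_single_self, LinearEquiv.coe_one, id_eq]
      module
  · have ht : 2 * Real.cos (2 * Real.pi / (M i j : ℕ)) =
        M.coroot i (Finsupp.single j 1) * M.coroot j (Finsupp.single i 1) - 2 := by
      rw [coroot_single, coroot_single, M.symmetric j i, mul_div_assoc, Real.cos_two_mul]
      ring
    obtain ⟨e₁, e₂⟩ := chebyshev_S_eval_two_mul_cos_eq_zero h _ rfl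
    ext1 z
    rw [geomReflection, geomReflection,
      Module.reflection_mul_reflection_pow_apply _ _ _ z _ ht, e₁, e₂]
    simp

lemma CoxeterSystem.simple_injective (cs : CoxeterSystem M W) : Function.Injective cs.simple := by
  intro i j h
  have h' := congrArg (cs.lift ⟨_, M.isLiftable_geomReflection⟩) h
  rw [lift_apply_simple, lift_apply_simple] at h'
  have h' := congrArg (fun f => f (Finsupp.single i 1) i) h'
  by_contra hij
  simp [CoxeterMatrix.geomReflection, Module.reflection_apply, Ne.symm hij] at h'
  norm_num at h'

namespace CoxeterSystem

open List

open Classical in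
/-- The action of `i` on signed elements of `W`: conjugation by `s_i`, with a change of sign
at `s_i`. -/
noncomputable def signedConj (cs : CoxeterSystem M W) (i : B) : Function.End (W × ZMod 2) :=
  fun p => (cs.simple i * p.1 * cs.simple i, p.2 + if p.1 = cs.simple i then 1 else 0)

open Classical in
lemma signedConj_mul_pow_apply (cs : CoxeterSystem M W) (i j : B) (k : ℕ) (t : W) (ε : ZMod 2) :
    ((cs.signedConj i * cs.signedConj j) ^ k : Function.End (W × ZMod 2)) (t, ε) =
      ((cs.simple i * cs.simple j) ^ k * t * ((cs.simple i * cs.simple j) ^ k)⁻¹,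
        ε + ∑ n ∈ Finset.range (2 * k),
          if t = cs.simple j * (cs.simple i * cs.simple j) ^ n then 1 else 0) := by
  induction k with
  | zero => simp; rfl
  | succ k ih =>
    set r := cs.simple i * cs.simple j with hr
    have hji : cs.simple j * r * cs.simple j = r⁻¹ := by simp [hr, ← mul_assoc]
    have hconj (n : ℕ) : cs.simple j * r ^ n * cs.simple j = (r ^ n)⁻¹ := by
      induction n with
      | zero => simp
      | succ n ihn =>
        calc cs.simple j * r ^ (n + 1) * cs.simple j
            = cs.simple j * r ^ n * cs.simple j * (cs.simple j * r * cs.simple j) := by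
              simp [pow_succ, mul_assoc]
          _ = (r ^ (n + 1))⁻¹ := by rw [ihn, hji, pow_succ', mul_inv_rev r]
    have hcomm (n : ℕ) : (r ^ n)⁻¹ * cs.simple j = cs.simple j * r ^ n := by
      rw [← hconj]; simp [mul_assoc]
    have h1 : r ^ k * t * (r ^ k)⁻¹ = cs.simple j ↔ t = cs.simple j * r ^ (2 * k) := by
      rw [mul_inv_eq_iff_eq_mul, ← eq_inv_mul_iff_mul_eq, ← mul_assoc, hcomm, two_mul, pow_add,
        mul_assoc]
    have h2 : cs.simple j * (r ^ k * t * (r ^ k)⁻¹) * cs.simple j = cs.simple i ↔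
        t = cs.simple j * r ^ (2 * k + 1) := by
      have : cs.simple i = r * cs.simple j := by simp [hr]
      rw [this, mul_left_inj, ← eq_inv_mul_iff_mul_eq, inv_simple, mul_inv_eq_iff_eq_mul,
        ← eq_inv_mul_iff_mul_eq, mul_assoc, ← mul_assoc _ (cs.simple j), hcomm,
        two_mul, pow_succ, pow_add]
      simp only [mul_assoc, ← pow_succ, ← pow_succ']
    have h3 : cs.simple i * (cs.simple j * (r ^ k * t * (r ^ k)⁻¹) * cs.simple j) * cs.simple i =
        r ^ (k + 1) * t * (r ^ (k + 1))⁻¹ := by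
      rw [pow_succ' r, mul_inv_rev, hr, mul_inv_rev]
      simp [mul_assoc]
    rw [pow_succ']
    change (cs.signedConj i) (cs.signedConj j
      (((cs.signedConj i * cs.signedConj j) ^ k : Function.End (W × ZMod 2)) (t, ε))) = _
    rw [ih]
    simp only [signedConj, h1, h2, h3, mul_add, mul_one, Finset.sum_range_succ]
    simp only [add_assoc]

lemma isLiftable_signedConj (cs : CoxeterSystem M W) : M.IsLiftable cs.signedConj := by
  classical
  intro i j
  funext ⟨t, ε⟩
  rw [signedConj_mul_pow_apply, two_mul, Finset.sum_range_add]
  simp [pow_add, CharTwo.add_self_eq_zero]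
  rfl

open Classical in
lemma lift_signedConj_wordProd (cs : CoxeterSystem M W) (ω : List B) (t : W) (ε : ZMod 2) :
    cs.lift ⟨_, cs.isLiftable_signedConj⟩ (cs.wordProd ω) (t, ε) =
      (cs.wordProd ω * t * (cs.wordProd ω)⁻¹, ε + ((cs.rightInvSeq ω).count t : ZMod 2)) := by
  induction ω with
  | nil => simp; rfl
  | cons i ω ih =>
    rw [wordProd_cons, map_mul, lift_apply_simple]
    change cs.signedConj i (cs.lift ⟨_, cs.isLiftable_signedConj⟩ (cs.wordProd ω) (t, ε)) = _
    have : cs.wordProd ω * t * (cs.wordProd ω)⁻¹ = cs.simple i ↔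
        (cs.wordProd ω)⁻¹ * cs.simple i * cs.wordProd ω = t := by
      rw [mul_inv_eq_iff_eq_mul, mul_assoc, inv_mul_eq_iff_eq_mul, eq_comm]
    rw [ih, signedConj, rightInvSeq, List.count_cons]
    simp only [this, beq_iff_eq]
    ext1
    · simp [mul_assoc]
    · push_cast; simp [add_assoc]

/-- A simple right descent of `π ω` occurs in the right inversion sequence of `ω`. -/
lemma simple_mem_rightInvSeq (cs : CoxeterSystem M W) {ω : List B} {i : B}
    (h : cs.IsRightDescent (cs.wordProd ω) i) : cs.simple i ∈ cs.rightInvSeq ω := by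
  classical
  by_contra hmem
  obtain ⟨ω', hω', he⟩ := cs.exists_isReduced (cs.wordProd ω * cs.simple i)
  have h1 := cs.lift_signedConj_wordProd ω (cs.simple i) 0
  have h2 := cs.lift_signedConj_wordProd ω' (cs.simple i) 0
  rw [← he, map_mul, lift_apply_simple] at h2
  change cs.lift ⟨_, cs.isLiftable_signedConj⟩ (cs.wordProd ω)
    (cs.signedConj i (cs.simple i, 0)) = _ at h2
  have h3 : cs.signedConj i (cs.simple i, 0) = (cs.simple i, 1) := by simp [signedConj]
  rw [h3, lift_signedConj_wordProd, List.count_eq_zero_of_not_mem hmem] at h2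
  have h4 : cs.simple i ∈ cs.rightInvSeq ω' := by
    by_contra h5
    rw [List.count_eq_zero_of_not_mem h5] at h2
    simp at h2
  have h5 := (cs.isRightInversion_of_mem_rightInvSeq hω' h4).2
  rw [← he] at h5
  have h6 : cs.length (cs.wordProd ω * cs.simple i) < cs.length (cs.wordProd ω) := h
  simp at h5
  omega

/-- The exchange property. -/
lemma exists_mul_simple_eq_wordProd_eraseIdx (cs : CoxeterSystem M W) {ω : List B} {i : B}
    (h : cs.IsRightDescent (cs.wordProd ω) i) :
    ∃ j < ω.length, cs.wordProd ω * cs.simple i = cs.wordProd (ω.eraseIdx j) := by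
  obtain ⟨j, hj, he⟩ := List.getElem_of_mem (cs.simple_mem_rightInvSeq h)
  refine ⟨j, by simpa using hj, ?_⟩
  rw [← wordProd_mul_getD_rightInvSeq, List.getD_eq_getElem _ _ hj, he]

/-! ### Parabolic subgroups -/

lemma simple_mem_parabolic (cs : CoxeterSystem M W) {K : Set B} {i : B} (h : i ∈ K) :
    cs.simple i ∈ cs.parabolic K :=
  Subgroup.subset_closure ⟨i, h, rfl⟩

lemma wordProd_mem_parabolic (cs : CoxeterSystem M W) {K : Set B} {ω : List B}
    (h : ∀ i ∈ ω, i ∈ K) : cs.wordProd ω ∈ cs.parabolic K := by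
  refine Subgroup.list_prod_mem _ fun x hx => ?_
  obtain ⟨i, hi, rfl⟩ := List.mem_map.1 hx
  exact cs.simple_mem_parabolic (h i hi)

/-- Every element of `W_K` has a reduced word with letters in `K`. -/
lemma exists_isReduced_of_mem_parabolic (cs : CoxeterSystem M W) {K : Set B} {u : W}
    (hu : u ∈ cs.parabolic K) :
    ∃ ω : List B, cs.IsReduced ω ∧ (∀ i ∈ ω, i ∈ K) ∧ u = cs.wordProd ω := by
  have step {x : W} {i : B} (hi : i ∈ K)
      (hx : ∃ ω : List B, cs.IsReduced ω ∧ (∀ i ∈ ω, i ∈ K) ∧ x = cs.wordProd ω) :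
      ∃ ω : List B, cs.IsReduced ω ∧ (∀ i ∈ ω, i ∈ K) ∧ x * cs.simple i = cs.wordProd ω := by
    obtain ⟨ω, hω, hK, rfl⟩ := hx
    by_cases h : cs.IsRightDescent (cs.wordProd ω) i
    · obtain ⟨j, hj, he⟩ := cs.exists_mul_simple_eq_wordProd_eraseIdx h
      refine ⟨_, ?_, fun k hk => hK k (List.mem_of_mem_eraseIdx hk), he⟩
      rw [isRightDescent_iff, he, hω.eq] at h
      rw [IsReduced, List.length_eraseIdx_of_lt hj]
      omega
    · refine ⟨ω ++ [i], ?_, ?_, by simp [wordProd_append]⟩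
      · rw [not_isRightDescent_iff, hω.eq] at h
        simp [IsReduced, wordProd_append, h]
      · simp only [List.mem_append, List.mem_singleton]
        rintro k (hk | rfl)
        exacts [hK k hk, hi]
  induction hu using Subgroup.closure_induction_right with
  | one => exact ⟨[], by simp [IsReduced], by simp, by simp⟩
  | mul_right x _ y hy ih =>
    obtain ⟨i, hi, rfl⟩ := hy
    exact step hi ih
  | mul_inv_cancel x _ y hy ih =>
    obtain ⟨i, hi, rfl⟩ := hy
    rw [inv_simple]
    exact step hi ih

/-- The simple reflection at a right descent of an element of `W_K` belongs to `W_K`. -/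
lemma simple_mem_parabolic_of_isRightDescent (cs : CoxeterSystem M W) {K : Set B} {u : W} {i : B}
    (hu : u ∈ cs.parabolic K) (h : cs.IsRightDescent u i) : cs.simple i ∈ cs.parabolic K := by
  obtain ⟨ω, -, hK, rfl⟩ := cs.exists_isReduced_of_mem_parabolic hu
  obtain ⟨j, -, he⟩ := cs.exists_mul_simple_eq_wordProd_eraseIdx h
  have := cs.wordProd_mem_parabolic fun k hk => hK k (List.mem_of_mem_eraseIdx (i := j) hk)
  rw [← he] at this
  exact (Subgroup.mul_mem_cancel_left _ hu).1 this

lemma simple_mem_parabolic_iff (cs : CoxeterSystem M W) {K : Set B} {i : B} :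
    cs.simple i ∈ cs.parabolic K ↔ i ∈ K := by
  refine ⟨fun h => ?_, cs.simple_mem_parabolic⟩
  obtain ⟨ω, hω, hK, he⟩ := cs.exists_isReduced_of_mem_parabolic h
  have hl := hω.eq
  rw [← he, length_simple] at hl
  obtain ⟨j, rfl⟩ := List.length_eq_one_iff.1 hl.symm
  rw [wordProd_singleton] at he
  exact cs.simple_injective he ▸ hK j (by simp)

/-- A nontrivial element of `W_K` has a right descent in `K`. -/
lemma exists_isRightDescent_of_mem_parabolic (cs : CoxeterSystem M W) {K : Set B} {u : W}
    (hu : u ∈ cs.parabolic K) (h1 : u ≠ 1) : ∃ i ∈ K, cs.IsRightDescent u i := by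
  obtain ⟨i, hi⟩ := cs.exists_rightDescent_of_ne_one h1
  exact ⟨i, cs.simple_mem_parabolic_iff.1 (cs.simple_mem_parabolic_of_isRightDescent hu hi), hi⟩

/-- Lengths add up when an element of shortest length in its coset is multiplied by an element
of `W_K`. -/
lemma length_mul_of_forall_length_le (cs : CoxeterSystem M W) {K : Set B} {x u : W}
    (hx : ∀ v ∈ cs.parabolic K, cs.length x ≤ cs.length (x * v)) (hu : u ∈ cs.parabolic K) :
    cs.length (x * u) = cs.length x + cs.length u := by
  obtain ⟨ω, hω, hK, rfl⟩ := cs.exists_isReduced_of_mem_parabolic hu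
  clear hu
  induction ω using List.reverseRecOn with
  | nil => simp
  | append_singleton ω i ih =>
    have hω' : cs.IsReduced ω := by simpa using hω.take ω.length
    have hK' : ∀ k ∈ ω, k ∈ K := fun k hk => hK k (by simp [hk])
    have ih := ih hω' hK'
    have hl := hω.eq
    rw [hω'.eq] at ih
    rw [wordProd_append, wordProd_singleton, length_append, length_singleton] at hl
    rw [wordProd_append, wordProd_singleton, hl, ← add_assoc, ← ih, ← mul_assoc,
      ← not_isRightDescent_iff]
    intro hd
    obtain ⟨χ, hχ, rfl⟩ := cs.exists_isReduced x
    rw [← wordProd_append] at hd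
    obtain ⟨j, hj, he⟩ := cs.exists_mul_simple_eq_wordProd_eraseIdx hd
    rw [wordProd_append, mul_assoc] at he
    rcases lt_or_ge j χ.length with hlt | hge
    · rw [List.eraseIdx_append_of_lt_length hlt, wordProd_append] at he
      have hmem : cs.wordProd ω * cs.simple i * (cs.wordProd ω)⁻¹ ∈ cs.parabolic K :=
        mul_mem (mul_mem (cs.wordProd_mem_parabolic hK')
          (cs.simple_mem_parabolic (hK i (by simp)))) (inv_mem (cs.wordProd_mem_parabolic hK'))
      have h1 := hx _ hmem
      rw [← mul_assoc, ← mul_assoc, mul_assoc _ (cs.wordProd ω), he, mul_inv_cancel_right,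
        hχ.eq] at h1
      have h2 := cs.length_wordProd_le (χ.eraseIdx j)
      rw [List.length_eraseIdx_of_lt hlt] at h2
      omega
    · rw [List.eraseIdx_append_of_length_le hge, wordProd_append, mul_right_inj] at he
      rw [he] at hl
      have h2 := cs.length_wordProd_le (ω.eraseIdx (j - χ.length))
      have := List.length_eraseIdx_le ω (j - χ.length)
      omega

/-- A coset of `W_K` contains at most one element of `W^K`. -/
lemma eq_of_mem_minReps (cs : CoxeterSystem M W) {K : Set B} {x y : W}
    (hx : x ∈ cs.minReps K) (hy : y ∈ cs.minReps K) (hxy : x⁻¹ * y ∈ cs.parabolic K) : x = y := by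
  obtain ⟨v, hv, hmin⟩ := WellFounded.has_min
    (InvImage.wf (fun v => cs.length (x * v)) Nat.lt_wfRel.wf) (cs.parabolic K : Set W)
    ⟨1, one_mem _⟩
  have hle : ∀ u ∈ cs.parabolic K, cs.length (x * v) ≤ cs.length (x * v * u) := fun u hu => by
    rw [mul_assoc]
    exact not_lt.1 (hmin (v * u) (mul_mem hv hu))
  have key {z : W} (hz : z ∈ cs.minReps K) (h : (x * v)⁻¹ * z ∈ cs.parabolic K) : z = x * v := by
    by_contra hne
    have h1 : (x * v)⁻¹ * z ≠ 1 := fun h => hne (inv_mul_eq_one.1 h).symm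
    obtain ⟨i, hi, hd⟩ := cs.exists_isRightDescent_of_mem_parabolic h h1
    have e1 := cs.length_mul_of_forall_length_le hle h
    have e2 := cs.length_mul_of_forall_length_le hle (mul_mem h (cs.simple_mem_parabolic hi))
    rw [mul_inv_cancel_left] at e1
    rw [← mul_assoc, mul_inv_cancel_left] at e2
    have e3 := hz i hi
    rw [IsRightDescent] at hd
    omega
  rw [key hx (by simpa using hv),
    key hy (by rw [mul_inv_rev, mul_assoc]; exact mul_mem (inv_mem hv) hxy)]

lemma IsProjFamily.eq_of_mem_minReps {cs : CoxeterSystem M W} {P : Set B → W → W}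
    (hP : cs.IsProjFamily P) {K : Set B} {x w : W} (hx : x ∈ cs.minReps K)
    (h : x⁻¹ * w ∈ cs.parabolic K) : P K w = x := by
  refine cs.eq_of_mem_minReps (hP K w).1 hx ?_
  have := mul_mem (hP K w).2 (inv_mem h)
  rwa [mul_inv_rev, inv_inv, mul_assoc, mul_inv_cancel_left] at this

/-- If `i ∉ K` and `i k i ∈ W_K` for some `k ∈ K`, then `i` and `k` commute. -/
lemma commute_of_conj_mem_parabolic (cs : CoxeterSystem M W) {K : Set B} {i k : B} (hi : i ∉ K)
    (h : cs.simple i * cs.simple k * cs.simple i ∈ cs.parabolic K) :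
    Commute (cs.simple k) (cs.simple i) := by
  have h1 : ¬ cs.IsRightDescent (cs.simple i * cs.simple k * cs.simple i) i := fun hd =>
    hi (cs.simple_mem_parabolic_iff.1 (cs.simple_mem_parabolic_of_isRightDescent h hd))
  have h2 : cs.IsRightDescent (cs.wordProd [i, k]) i := by
    rw [isRightDescent_iff_not_isRightDescent_mul]
    simpa [wordProd_cons] using h1
  obtain ⟨j, hj, he⟩ := cs.exists_mul_simple_eq_wordProd_eraseIdx h2
  simp only [length_cons, length_nil] at hj
  interval_cases j
  · simp only [wordProd_cons, wordProd_nil, mul_one, eraseIdx_cons_zero] at he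
    rw [Commute, SemiconjBy]
    nth_rewrite 2 [← he]
    simp [← mul_assoc]
  · simp [wordProd_cons, mul_assoc] at he
    have := congrArg (· * cs.simple i) he
    simp only [simple_mul_simple_cancel_right, one_mul] at this
    rw [this]

/-- If `g ∈ W_K`, `k ∈ K` and `i ∉ K`, then `k` is a right descent of `g i` only if it commutes
with `i` and is a right descent of `g`. -/
lemma commute_and_isRightDescent_of_isRightDescent_mul_simple (cs : CoxeterSystem M W) {K : Set B}
    {g : W} {i k : B} (hg : g ∈ cs.parabolic K) (hi : i ∉ K) (hk : k ∈ K)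
    (hd : cs.IsRightDescent (g * cs.simple i) k) :
    Commute (cs.simple k) (cs.simple i) ∧ cs.IsRightDescent g k := by
  obtain ⟨ω, hω, hK, rfl⟩ := cs.exists_isReduced_of_mem_parabolic hg
  have hd' : cs.IsRightDescent (cs.wordProd (ω ++ [i])) k := by simpa [wordProd_append] using hd
  obtain ⟨j, hj, he⟩ := cs.exists_mul_simple_eq_wordProd_eraseIdx hd'
  rcases lt_or_ge j ω.length with hlt | hge
  · rw [List.eraseIdx_append_of_lt_length hlt] at he
    simp only [wordProd_append, wordProd_singleton] at he
    have hmem : cs.wordProd (ω.eraseIdx j) ∈ cs.parabolic K :=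
      cs.wordProd_mem_parabolic fun l hl => hK l (List.mem_of_mem_eraseIdx hl)
    have hc : Commute (cs.simple k) (cs.simple i) := by
      refine cs.commute_of_conj_mem_parabolic hi ((Subgroup.mul_mem_cancel_left _ hg).1 ?_)
      rw [← mul_assoc, ← mul_assoc, he]
      simpa using hmem
    refine ⟨hc, ?_⟩
    rw [mul_assoc, ← hc.eq, ← mul_assoc, mul_left_inj] at he
    have := cs.length_wordProd_le (ω.eraseIdx j)
    rw [List.length_eraseIdx_of_lt hlt] at this
    rw [IsRightDescent, he, hω.eq]
    omega
  · exfalso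
    simp only [length_append, length_singleton] at hj
    obtain rfl : j = ω.length := by omega
    simp [List.eraseIdx_append_of_length_le, wordProd_append, mul_assoc] at he
    rw [mul_eq_one_iff_eq_inv, inv_simple] at he
    exact hi (cs.simple_injective he ▸ hk)

/-- A word with distinct letters in which no two consecutive letters commute has only its last
letter as a right descent. -/
lemma eq_of_isRightDescent_wordProd_concat (cs : CoxeterSystem M W) {ω : List B} {i k : B}
    (hnodup : (ω ++ [i]).Nodup)
    (hchain : (ω ++ [i]).IsChain fun a b => ¬ Commute (cs.simple a) (cs.simple b))
    (hd : cs.IsRightDescent (cs.wordProd (ω ++ [i])) k) : k = i := by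
  induction ω using List.reverseRecOn generalizing i k with
  | nil =>
    rw [List.nil_append] at hd
    have := cs.simple_mem_parabolic_of_isRightDescent (K := {i})
      (cs.wordProd_mem_parabolic (by simp)) hd
    simpa using cs.simple_mem_parabolic_iff.1 this
  | append_singleton ω l ih =>
    by_contra hne
    rw [wordProd_append, wordProd_singleton] at hd
    rw [List.nodup_append] at hnodup
    obtain ⟨hc, hd'⟩ := cs.commute_and_isRightDescent_of_isRightDescent_mul_simple
      (K := insert k {x | x ∈ ω ++ [l]})
      (cs.wordProd_mem_parabolic fun x hx => Or.inr hx)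
      (by
        rintro (h | h)
        · exact hne h.symm
        · exact hnodup.2.2 _ h _ (by simp) rfl)
      (Or.inl rfl) hd
    rw [List.isChain_append] at hchain
    obtain rfl := ih hnodup.1 hchain.1 hd'
    exact hchain.2.2 k (by simp) i (by simp) hc

/-- The Coxeter graph, with edges between non-commuting generators. -/
def coxeterGraph (cs : CoxeterSystem M W) : SimpleGraph B where
  Adj a b := ¬ Commute (cs.simple a) (cs.simple b)
  symm := ⟨fun _ _ h h' => h h'.symm⟩
  loopless := ⟨fun _ h => h (Commute.refl _)⟩

/-- In a connected set `I`, any point of `I ∩ J` can be joined to `I \ J` inside `I ∩ J`. -/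
lemma IsConnected.exists_walk_to_diff {cs : CoxeterSystem M W} {I J : Set B}
    (hI : cs.IsConnected I) (hIJ : ¬ I ⊆ J) {c : B} (hc : c ∈ I ∩ J) :
    ∃ a ∈ I \ J, ∃ p : cs.coxeterGraph.Walk c a, ∀ x ∈ p.support, x ∈ I ∩ J ∨ x = a := by
  obtain ⟨a, haI, haJ⟩ := Set.not_subset.1 hIJ
  have h := hI.2 c hc.1 a haI
  induction h using Relation.ReflTransGen.head_induction_on with
  | refl => exact absurd hc.2 haJ
  | @head c d hcd _ ih =>
    have hadj : cs.coxeterGraph.Adj c d := hcd.2.2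
    by_cases hd : d ∈ J
    · obtain ⟨b, hb, p, hp⟩ := ih ⟨hcd.2.1, hd⟩
      refine ⟨b, hb, .cons hadj p, fun x hx => ?_⟩
      rw [SimpleGraph.Walk.support_cons, List.mem_cons] at hx
      rcases hx with rfl | hx
      exacts [Or.inl hc, hp x hx]
    · refine ⟨d, ⟨hcd.2.1, hd⟩, .cons hadj .nil, fun x hx => ?_⟩
      simp only [SimpleGraph.Walk.support_cons, SimpleGraph.Walk.support_nil, List.mem_cons,
        List.not_mem_nil, or_false] at hx
      rcases hx with rfl | rfl
      exacts [Or.inl hc, Or.inr rfl]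

lemma IsConnected.exists_walk_diff_diff {cs : CoxeterSystem M W} {I J : Set B}
    (hI : cs.IsConnected I) (hJ : cs.IsConnected J) (hIJ : ¬ I ⊆ J) (hJI : ¬ J ⊆ I)
    (hcomm : ¬ ∀ s ∈ I, ∀ t ∈ J, Commute (cs.simple s) (cs.simple t)) :
    ∃ a ∈ I \ J, ∃ b ∈ J \ I, ∃ p : cs.coxeterGraph.Walk a b,
      ∀ x ∈ p.support, x ∈ I ∩ J ∨ x = a ∨ x = b := by
  rcases (I ∩ J).eq_empty_or_nonempty with h | ⟨c, hc⟩
  · push Not at hcomm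
    obtain ⟨a, ha, b, hb, hab⟩ := hcomm
    have hadj : cs.coxeterGraph.Adj a b := hab
    refine ⟨a, ⟨ha, fun h' => h.subset ⟨ha, h'⟩⟩, b, ⟨hb, fun h' => h.subset ⟨h', hb⟩⟩,
      .cons hadj .nil, fun x hx => Or.inr ?_⟩
    simpa using hx
  · obtain ⟨a, ha, p, hp⟩ := hI.exists_walk_to_diff hIJ hc
    obtain ⟨b, hb, q, hq⟩ := hJ.exists_walk_to_diff hJI hc.symm
    refine ⟨a, ha, b, hb, p.reverse.append q, fun x hx => ?_⟩
    rw [SimpleGraph.Walk.mem_support_append_iff, SimpleGraph.Walk.support_reverse,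
      List.mem_reverse] at hx
    rcases hx with hx | hx
    · exact (hp x hx).imp_right Or.inl
    · exact (hq x hx).imp And.symm Or.inr

end CoxeterSystem

theorem stmt_4 (cs : CoxeterSystem M W) (P : Set B → W → W) (hP : cs.IsProjFamily P)
    (I J : Set B) (hI : cs.IsConnected I) (hJ : cs.IsConnected J)
    (hcomm : ∀ w : W, P I (P J w) = P J (P I w)) :
    (∀ s ∈ I, ∀ t ∈ J, Commute (cs.simple s) (cs.simple t)) ∨ I ⊆ J ∨ J ⊆ I := by
  classical
  by_contra! ⟨hst, hIJ, hJI⟩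
  obtain ⟨a, ha, b, hb, p, hp⟩ := hI.exists_walk_diff_diff hJ hIJ hJI (by push Not; exact hst)
  have hsupp : ∀ x ∈ p.bypass.support, x ∈ I ∩ J ∨ x = a ∨ x = b :=
    fun x hx => hp x (p.support_bypass_subset_support hx)
  have hnodup := p.bypass_isPath.support_nodup
  have hchain := p.bypass.isChain_adj_support
  have hcons := p.bypass.cons_tail_support.symm
  obtain ⟨ω, hω⟩ : ∃ ω, p.bypass.support = ω ++ [b] :=
    ⟨_, p.bypass.dropLast_support_concat.symm⟩
  generalize p.bypass.support.tail = χ at hcons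
  generalize p.bypass.support = L at *
  have hωI : ∀ x ∈ ω, x ∈ I := by
    intro x hx
    rcases hsupp x (by simp [hω, hx]) with h | rfl | rfl
    · exact h.1
    · exact ha.1
    · rw [hω, List.nodup_append] at hnodup
      exact absurd rfl (hnodup.2.2 _ hx _ (by simp))
  have hχJ : ∀ x ∈ χ, x ∈ J := by
    intro x hx
    rcases hsupp x (by simp [hcons, hx]) with h | rfl | rfl
    · exact h.2
    · rw [hcons, List.nodup_cons] at hnodup
      exact absurd hx hnodup.1
    · exact hb.1
  have hPI : P I (cs.wordProd L) = cs.wordProd L := by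
    refine hP.eq_of_mem_minReps (fun s hs => ?_) (by simp [one_mem])
    by_contra hd
    have hd : cs.IsRightDescent (cs.wordProd L) s :=
      lt_of_le_of_ne (not_lt.1 hd) (cs.length_mul_simple_ne _ _)
    rw [hω] at hd hnodup hchain
    exact hb.2 (cs.eq_of_isRightDescent_wordProd_concat hnodup hchain hd ▸ hs)
  have hPJ : P J (cs.wordProd L) = cs.simple a := by
    refine hP.eq_of_mem_minReps (fun s hs => ?_) ?_
    · by_contra hd
      have hd : cs.IsRightDescent (cs.simple a) s :=
        lt_of_le_of_ne (not_lt.1 hd) (cs.length_mul_simple_ne _ _)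
      have := cs.simple_mem_parabolic_of_isRightDescent (K := {a})
        (cs.simple_mem_parabolic rfl) hd
      rw [CoxeterSystem.simple_mem_parabolic_iff, Set.mem_singleton_iff] at this
      exact ha.2 (this ▸ hs)
    · rw [hcons, CoxeterSystem.wordProd_cons, inv_mul_cancel_left]
      exact cs.wordProd_mem_parabolic hχJ
  have hPa : P I (cs.simple a) = 1 :=
    hP.eq_of_mem_minReps (fun s _ => by simp) (by simpa using cs.simple_mem_parabolic ha.1)
  have h := hcomm (cs.wordProd L)
  rw [hPI, hPJ, hPa] at h
  have hl := cs.length_simple a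
  simp [← h] at hl
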